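/- arXiv:2103.06679 — 2 statements merged into one kernel-verified Lean document; each statement's English description precedes it below -/
import Mathlib

section
/- Let H be a finite group and let m(H) denote the minimal dimension of a nontrivial complex irreducible representation of H. If A₁, A₂, A₃ are subsets of H with |A₁|·|A₂|·|A₃| > |H|³/m(H), then A₁A₂A₃ = H. -/
open scoped Pointwise

/-- The minimal dimension of a nontrivial complex irreducible representation of
a finite group `H`. -/
noncomputable def minNontrivialIrrepDim (H : Type) [Group H] [Fintype H] : ℕ :=
  sInf { n : ℕ | ∃ V : FDRep ℂ H, CategoryTheory.Simple V ∧ (∃ g : H, V.ρ g ≠ 1) ∧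
      Module.finrank ℂ V = n }

open CategoryTheory

universe u v

theorem FDRep.injective_of_mono {k : Type u} {G : Type v} [Field k] [Group G] {V W : FDRep k G}
    (f : V ⟶ W) [Mono f] : Function.Injective f.hom.hom.hom :=
  (Rep.mono_iff_injective ((forget₂ (FDRep k G) (Rep k G)).map f)).1 inferInstance

theorem FDRep.isIso_of_bijective {k : Type u} {G : Type v} [Field k] [Group G] {V W : FDRep k G}
    (f : V ⟶ W) (hf : Function.Bijective f.hom.hom.hom) : IsIso f := by
  have : IsIso ((forget₂ (FGModuleCat k) (ModuleCat k)).map f.hom) :=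
    (ConcreteCategory.isIso_iff_bijective _).2 hf
  have : IsIso f.hom := isIso_of_reflects_iso f.hom (forget₂ (FGModuleCat k) (ModuleCat k))
  exact Action.isIso_of_hom_isIso f

theorem FDRep.simple_of_isIrreducible {k W : Type u} {G : Type v} [Field k] [Group G]
    [AddCommGroup W] [Module k W] [Module.Finite k W] (ρ : Representation k G W)
    [ρ.IsIrreducible] :
    Simple (FDRep.of ρ) where
  mono_isIso_iff_nonzero {Y} f _ := by
    constructor
    · rintro h rfl
      have hzero : ∀ w : W, w = 0 := fun w ↦ by
        have := IsIso.inv_hom_id (0 : Y ⟶ FDRep.of ρ)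
        exact (congrArg (fun φ : FDRep.of ρ ⟶ FDRep.of ρ ↦ φ.hom.hom.hom w) this).symm
      refine bot_ne_top (α := Subrepresentation ρ) ?_
      ext w
      simp [hzero w]
    · intro hf
      let R : Subrepresentation ρ :=
        ⟨LinearMap.range f.hom.hom.hom, by
          rintro g _ ⟨y, rfl⟩
          exact ⟨Y.ρ g y, congrArg (fun φ ↦ φ.hom.hom y) (f.comm g)⟩⟩
      refine FDRep.isIso_of_bijective f ⟨FDRep.injective_of_mono f, ?_⟩
      rcases eq_bot_or_eq_top R with hR | hR
      · refine absurd ?_ hf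
        ext y
        exact LinearMap.congr_fun
          (LinearMap.range_eq_bot.1 (congrArg Subrepresentation.toSubmodule hR)) y
      · exact LinearMap.range_eq_top.1 (congrArg Subrepresentation.toSubmodule hR)

theorem Subrepresentation.isIrreducible_of_isAtom {k G E : Type*} [Field k] [Group G]
    [AddCommGroup E] [Module k E] {ρ : Representation k G E} {Q : Subrepresentation ρ}
    (hQ : IsAtom Q) : Q.toRepresentation.IsIrreducible where
  exists_pair_ne := by
    refine ⟨⊥, ⊤, fun h ↦ hQ.1 (Subrepresentation.toSubmodule_injective ?_)⟩
    have : (⊥ : Submodule k Q.toSubmodule) = ⊤ :=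
      congrArg Subrepresentation.toSubmodule h
    exact (Submodule.subsingleton_iff_eq_bot).1
      ((Submodule.subsingleton_iff k).1 (subsingleton_of_bot_eq_top this))
  eq_bot_or_eq_top R := by
    let S : Subrepresentation ρ := ⟨R.toSubmodule.map Q.toSubmodule.subtype, by
      rintro g _ ⟨y, hy, rfl⟩
      exact ⟨_, R.apply_mem_toSubmodule g hy, rfl⟩⟩
    have hSQ : S ≤ Q := Submodule.map_subtype_le Q.toSubmodule R.toSubmodule
    rcases hQ.le_iff.1 hSQ with h | h
    · left
      apply Subrepresentation.toSubmodule_injective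
      have : R.toSubmodule.map Q.toSubmodule.subtype = ⊥ :=
        congrArg Subrepresentation.toSubmodule h
      apply Submodule.map_injective_of_injective Q.toSubmodule.injective_subtype
      rw [this]
      exact (Submodule.map_bot _).symm
    · right
      apply Subrepresentation.toSubmodule_injective
      have : R.toSubmodule.map Q.toSubmodule.subtype = Q.toSubmodule :=
        congrArg Subrepresentation.toSubmodule h
      apply Submodule.map_injective_of_injective Q.toSubmodule.injective_subtype
      rw [this]
      exact (Submodule.map_subtype_top _).symm

theorem Subrepresentation.exists_isAtom_le {k G E : Type*} [Field k] [Group G]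
    [AddCommGroup E] [Module k E] [Module.Finite k E] {ρ : Representation k G E}
    {P : Subrepresentation ρ} (hP : P ≠ ⊥) : ∃ Q, IsAtom Q ∧ Q ≤ P := by
  have : WellFoundedLT (Subrepresentation ρ) :=
    ⟨InvImage.wf Subrepresentation.toSubmodule (wellFounded_lt (α := Submodule k E))⟩
  have := isAtomic_of_orderBot_wellFounded_lt (wellFounded_lt (α := Subrepresentation ρ))
  exact (eq_bot_or_exists_atom_le P).resolve_left hP

/-- A nonzero subrepresentation without nonzero fixed vectors has dimension at least the minimal
dimension of a nontrivial irreducible representation; in particular the latter is attained. -/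
theorem minNontrivialIrrepDim_pos_and_le_finrank {H E : Type} [Group H] [Fintype H]
    [AddCommGroup E] [Module ℂ E] [Module.Finite ℂ E] {ρ : Representation ℂ H E}
    (P : Subrepresentation ρ) (hP : P ≠ ⊥)
    (hfix : ∀ v ∈ P.toSubmodule, (∀ g, ρ g v = v) → v = 0) :
    0 < minNontrivialIrrepDim H ∧
      minNontrivialIrrepDim H ≤ Module.finrank ℂ P.toSubmodule := by
  obtain ⟨Q, hQ, hQP⟩ := Subrepresentation.exists_isAtom_le hP
  have hirr := Subrepresentation.isIrreducible_of_isAtom hQ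
  obtain ⟨v, hvQ, hv⟩ : ∃ v ∈ Q.toSubmodule, v ≠ 0 :=
    Submodule.exists_mem_ne_zero_of_ne_bot
      fun h ↦ hQ.1 (Subrepresentation.toSubmodule_injective h)
  have hmem : Module.finrank ℂ Q.toSubmodule ∈ { n : ℕ | ∃ V : FDRep ℂ H,
      CategoryTheory.Simple V ∧ (∃ g : H, V.ρ g ≠ 1) ∧ Module.finrank ℂ V = n } := by
    refine ⟨FDRep.of Q.toRepresentation, FDRep.simple_of_isIrreducible _, ?_, rfl⟩
    by_contra! h
    exact hv (hfix v (hQP hvQ) fun g ↦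
      congrArg Subtype.val (LinearMap.congr_fun (h g) (⟨v, hvQ⟩ : Q.toSubmodule)))
  refine ⟨?_, (Nat.sInf_le hmem).trans (Submodule.finrank_mono hQP)⟩
  obtain ⟨V, hV, ⟨g, hg⟩, hdim⟩ := Nat.sInf_mem ⟨_, hmem⟩
  refine Nat.pos_of_ne_zero fun h0 ↦ hg ?_
  have : Subsingleton V := Module.finrank_zero_iff.1 (hdim.trans h0)
  exact LinearMap.ext fun x ↦ Subsingleton.elim _ _

theorem LinearMap.exists_hasEigenvalue_adjoint_comp_self {E F : Type*} [NormedAddCommGroup E]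
    [InnerProductSpace ℂ E] [FiniteDimensional ℂ E] [Nontrivial E] [NormedAddCommGroup F]
    [InnerProductSpace ℂ F] [FiniteDimensional ℂ F] (T : E →ₗ[ℂ] F) :
    ∃ μ : ℝ, Module.End.HasEigenvalue (T.adjoint ∘ₗ T) (μ : ℂ) ∧
      ∀ x, ‖T x‖ ^ 2 ≤ μ * ‖x‖ ^ 2 := by
  have hsymm : (T.adjoint ∘ₗ T).IsSymmetric := fun x y ↦ by
    simp only [LinearMap.comp_apply, LinearMap.adjoint_inner_left, LinearMap.adjoint_inner_right]
  refine ⟨_, hsymm.hasEigenvalue_iSup_of_finiteDimensional, fun x ↦ ?_⟩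
  have hre : ∀ x, RCLike.re (inner ℂ ((T.adjoint ∘ₗ T) x) x) = ‖T x‖ ^ 2 := fun x ↦ by
    rw [LinearMap.comp_apply, LinearMap.adjoint_inner_left, inner_self_eq_norm_sq]
  rcases eq_or_ne x 0 with rfl | hx
  · simp
  have hx' : 0 < ‖x‖ ^ 2 := by positivity
  rw [← div_le_iff₀ hx']
  simp only [hre]
  refine le_ciSup (f := fun y : {y : E // y ≠ 0} ↦ ‖T y‖ ^ 2 / ‖(y : E)‖ ^ 2) ?_ ⟨x, hx⟩
  refine ⟨‖LinearMap.toContinuousLinearMap T‖ ^ 2, ?_⟩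
  rintro _ ⟨⟨y, hy⟩, rfl⟩
  have hy' : 0 < ‖y‖ ^ 2 := by positivity
  rw [div_le_iff₀ hy', ← mul_pow]
  gcongr
  exact (LinearMap.toContinuousLinearMap T).le_opNorm y

theorem LinearMap.mul_finrank_eigenspace_le {E F ι : Type*} [NormedAddCommGroup E]
    [InnerProductSpace ℂ E] [FiniteDimensional ℂ E] [NormedAddCommGroup F]
    [InnerProductSpace ℂ F] [FiniteDimensional ℂ F] [Fintype ι] (T : E →ₗ[ℂ] F) (μ : ℝ)
    (b : OrthonormalBasis ι ℂ F) :
    μ * Module.finrank ℂ (Module.End.eigenspace (T.adjoint ∘ₗ T) (μ : ℂ)) ≤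
      ∑ i, ‖T.adjoint (b i)‖ ^ 2 := by
  set K := Module.End.eigenspace (T.adjoint ∘ₗ T) (μ : ℂ)
  let u := stdOrthonormalBasis ℂ K
  have hu : Orthonormal ℂ fun j ↦ (u j : E) := u.orthonormal.comp_linearIsometry K.subtypeₗᵢ
  have hnorm : ∀ j, ‖T (u j)‖ ^ 2 = μ := fun j ↦ by
    have h1 : T.adjoint (T (u j)) = (μ : ℂ) • (u j : E) := Module.End.mem_eigenspace_iff.1 (u j).2
    have h2 : inner ℂ (u j : E) (T.adjoint (T (u j))) = ((‖T (u j)‖ ^ 2 : ℝ) : ℂ) := by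
      rw [LinearMap.adjoint_inner_right, inner_self_eq_norm_sq_to_K]
      simp
    rw [h1, inner_smul_right, inner_self_eq_norm_sq_to_K, hu.1 j] at h2
    have h3 : ((‖T (u j)‖ ^ 2 : ℝ) : ℂ) = (μ : ℂ) := by simpa using h2.symm
    exact_mod_cast h3
  calc μ * Module.finrank ℂ K = ∑ j, ‖T (u j)‖ ^ 2 := by simp [hnorm, mul_comm]
    _ = ∑ j, ∑ i, ‖inner ℂ (u j : E) (T.adjoint (b i))‖ ^ 2 := by
      refine Finset.sum_congr rfl fun j _ ↦ ?_
      rw [← b.sum_sq_norm_inner_left (T (u j))]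
      simp only [LinearMap.adjoint_inner_right]
    _ = ∑ i, ∑ j, ‖inner ℂ (u j : E) (T.adjoint (b i))‖ ^ 2 := Finset.sum_comm
    _ ≤ ∑ i, ‖T.adjoint (b i)‖ ^ 2 :=
      Finset.sum_le_sum fun i _ ↦ hu.sum_inner_products_le _

section Convolution

variable {H : Type} [Group H] [Fintype H]

/-- Left convolution by `f` on the space of complex functions on a finite group. -/
noncomputable def convolutionOperator [DecidableEq H] (f : H → ℂ) :
    EuclideanSpace ℂ H →ₗ[ℂ] EuclideanSpace ℂ H :=
  Matrix.toEuclideanLin (Matrix.of fun x y ↦ f (x * y⁻¹))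

theorem convolutionOperator_apply [DecidableEq H] (f : H → ℂ) (v : EuclideanSpace ℂ H) (x : H) :
    convolutionOperator f v x = ∑ y, f (x * y⁻¹) * v y := by
  simp [convolutionOperator, Matrix.toLpLin_apply, Matrix.mulVec, dotProduct]

theorem adjoint_convolutionOperator [DecidableEq H] (f : H → ℂ) :
    (convolutionOperator f).adjoint = convolutionOperator fun x ↦ star (f x⁻¹) := by
  rw [convolutionOperator, ← Matrix.toEuclideanLin_conjTranspose_eq_adjoint, convolutionOperator]
  congr 1
  ext x y
  simp

/-- The right regular representation on the complex functions on a finite group. -/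
noncomputable def rightRegularRepresentation (H : Type) [Group H] [Fintype H] :
    Representation ℂ H (EuclideanSpace ℂ H) where
  toFun g :=
    { toFun v := WithLp.toLp 2 fun x ↦ v (x * g)
      map_add' _ _ := rfl
      map_smul' _ _ := rfl }
  map_one' := by ext; simp
  map_mul' g h := by
    refine LinearMap.ext fun v ↦ ?_
    ext x
    exact congrArg v (mul_assoc x g h).symm

theorem rightRegularRepresentation_apply (g : H) (v : EuclideanSpace ℂ H) (x : H) :
    rightRegularRepresentation H g v x = v (x * g) := rfl

theorem convolutionOperator_rightRegularRepresentation [DecidableEq H] (f : H → ℂ) (g : H)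
    (v : EuclideanSpace ℂ H) :
    convolutionOperator f (rightRegularRepresentation H g v) =
      rightRegularRepresentation H g (convolutionOperator f v) := by
  ext x
  simp only [convolutionOperator_apply, rightRegularRepresentation_apply]
  exact Fintype.sum_equiv (Equiv.mulRight g) _ _ fun y ↦ by simp [mul_assoc]

theorem sum_convolutionOperator [DecidableEq H] (f : H → ℂ) (v : EuclideanSpace ℂ H) :
    ∑ x, convolutionOperator f v x = (∑ x, f x) * ∑ x, v x := by
  simp only [convolutionOperator_apply]
  rw [Finset.sum_comm, Finset.mul_sum]
  refine Finset.sum_congr rfl fun y _ ↦ ?_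
  rw [← Finset.sum_mul]
  congr 1
  exact Fintype.sum_equiv (Equiv.mulRight y⁻¹) _ _ fun x ↦ rfl

theorem norm_adjoint_convolutionOperator_basisFun_sq [DecidableEq H] (f : H → ℂ) (x : H) :
    ‖(convolutionOperator f).adjoint (EuclideanSpace.basisFun H ℂ x)‖ ^ 2 = ∑ y, ‖f y‖ ^ 2 := by
  rw [adjoint_convolutionOperator, EuclideanSpace.norm_sq_eq]
  simp only [convolutionOperator_apply]
  refine Fintype.sum_equiv ((Equiv.inv H).trans (Equiv.mulLeft x)) _ _ fun y ↦ ?_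
  simp [PiLp.single_apply]

/-- A function with vanishing sum that is fixed by all right translations is zero. -/
theorem eq_zero_of_rightRegularRepresentation_eq {v : EuclideanSpace ℂ H} (hsum : ∑ x, v x = 0)
    (hfix : ∀ g, rightRegularRepresentation H g v = v) : v = 0 := by
  have hconst : ∀ x, v x = v 1 := fun x ↦ by
    simpa [rightRegularRepresentation_apply] using
      congrArg (fun w : EuclideanSpace ℂ H ↦ w 1) (hfix x)
  ext x
  simp_rw [hconst] at hsum ⊢
  simpa using hsum

theorem minNontrivialIrrepDim_pos [Nontrivial H] : 0 < minNontrivialIrrepDim H := by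
  classical
  let P : Subrepresentation (rightRegularRepresentation H) :=
    { toSubmodule :=
        { carrier := {v | ∑ x, v x = 0}
          add_mem' := fun {a b} ha hb ↦ by
            simp_all [Finset.sum_add_distrib]
          zero_mem' := by simp
          smul_mem' := fun c v hv ↦ by
            simp_all [← Finset.mul_sum] }
      apply_mem_toSubmodule := fun g v hv ↦
        (Fintype.sum_equiv (Equiv.mulRight g) _ _ fun x ↦ rfl).trans hv }
  refine (minNontrivialIrrepDim_pos_and_le_finrank P (fun h ↦ ?_) fun v hv ↦
    eq_zero_of_rightRegularRepresentation_eq hv).1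
  obtain ⟨a, ha⟩ := exists_ne (1 : H)
  let w : EuclideanSpace ℂ H := EuclideanSpace.single a 1 - EuclideanSpace.single 1 1
  have hw : w ∈ P.toSubmodule := by
    change ∑ x, w x = 0
    simp [w, PiLp.single_apply]
  rw [h] at hw
  have : w = 0 := hw
  simpa [w, PiLp.single_apply, ha] using congrArg (fun u : EuclideanSpace ℂ H ↦ u a) this

/-- Convolution by a function with vanishing sum has small operator norm. -/
theorem norm_convolutionOperator_sq_mul_le [DecidableEq H] {f : H → ℂ} (hf : ∑ x, f x = 0)
    (v : EuclideanSpace ℂ H) :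
    ‖convolutionOperator f v‖ ^ 2 * minNontrivialIrrepDim H ≤
      Fintype.card H * (∑ x, ‖f x‖ ^ 2) * ‖v‖ ^ 2 := by
  set T := convolutionOperator f
  obtain ⟨μ, hμ, hle⟩ := T.exists_hasEigenvalue_adjoint_comp_self
  rcases le_or_gt μ 0 with hμ0 | hμ0
  · have : ‖T v‖ ^ 2 ≤ 0 := (hle v).trans (mul_nonpos_of_nonpos_of_nonneg hμ0 (by positivity))
    calc _ ≤ (0 : ℝ) := mul_nonpos_of_nonpos_of_nonneg this (by positivity)
      _ ≤ _ := by positivity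
  let P : Subrepresentation (rightRegularRepresentation H) :=
    { toSubmodule := Module.End.eigenspace (T.adjoint ∘ₗ T) (μ : ℂ)
      apply_mem_toSubmodule := fun g w hw ↦ by
        rw [Module.End.mem_eigenspace_iff, LinearMap.comp_apply] at hw ⊢
        rw [adjoint_convolutionOperator] at hw ⊢
        rw [convolutionOperator_rightRegularRepresentation,
          convolutionOperator_rightRegularRepresentation, hw, map_smul] }
  have hdim := (minNontrivialIrrepDim_pos_and_le_finrank P
    (fun h ↦ hμ (congrArg Subrepresentation.toSubmodule h))
    fun w hw ↦ eq_zero_of_rightRegularRepresentation_eq ?_).2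
  · have htrace := T.mul_finrank_eigenspace_le μ (EuclideanSpace.basisFun H ℂ)
    simp only [T, norm_adjoint_convolutionOperator_basisFun_sq, Finset.sum_const,
      Finset.card_univ, nsmul_eq_mul] at htrace
    calc ‖T v‖ ^ 2 * minNontrivialIrrepDim H
        ≤ μ * ‖v‖ ^ 2 * Module.finrank ℂ P.toSubmodule := by
          gcongr
          exact hle v
      _ = μ * Module.finrank ℂ P.toSubmodule * ‖v‖ ^ 2 := by ring
      _ ≤ _ := by gcongr
  · have hw' : T.adjoint (T w) = (μ : ℂ) • w := Module.End.mem_eigenspace_iff.1 hw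
    have hsum := sum_convolutionOperator (fun x ↦ star (f x⁻¹)) (T w)
    have hf' : ∑ x, star (f x⁻¹) = 0 := by
      rw [← star_sum, Fintype.sum_equiv (Equiv.inv H) (fun x ↦ f x⁻¹) f fun _ ↦ rfl, hf, star_zero]
    rw [← adjoint_convolutionOperator, hw', hf', zero_mul] at hsum
    simpa [← Finset.mul_sum, hμ0.ne'] using hsum

end Convolution

theorem sum_norm_indicator_sub_average_sq_le {α : Type*} [Fintype α] [DecidableEq α]
    (A : Finset α) :
    ∑ x, ‖(if x ∈ A then 1 else 0 : ℂ) - (A.card : ℂ) / Fintype.card α‖ ^ 2 ≤ A.card := by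
  rcases isEmpty_or_nonempty α
  · simp
  have hn : (0 : ℝ) < Fintype.card α := by exact_mod_cast Fintype.card_pos
  set c : ℝ := A.card / Fintype.card α with hc
  have hterm : ∀ x, ‖(if x ∈ A then 1 else 0 : ℂ) - (A.card : ℂ) / Fintype.card α‖ ^ 2 =
      (1 - 2 * c) * (if x ∈ A then 1 else 0 : ℝ) + c ^ 2 := fun x ↦ by
    have : (if x ∈ A then 1 else 0 : ℂ) - (A.card : ℂ) / Fintype.card α =
        (((if x ∈ A then 1 else 0 : ℝ) - c : ℝ) : ℂ) := by
      rw [hc]; split_ifs <;> push_cast <;> rfl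
    rw [this, Complex.norm_real, Real.norm_eq_abs, sq_abs]
    split_ifs <;> ring
  have hcn : c * Fintype.card α = A.card := div_mul_cancel₀ _ hn.ne'
  simp_rw [hterm]
  rw [Finset.sum_add_distrib, ← Finset.mul_sum, Finset.sum_boole]
  simp only [Finset.filter_univ_mem, Finset.sum_const, Finset.card_univ, nsmul_eq_mul]
  have : (Fintype.card α : ℝ) * c ^ 2 = c * A.card := by rw [← hcn]; ring
  rw [this]
  have : 0 ≤ c * A.card := by positivity
  linarith

/-- If `g` is not of the form `a₁ * a₂ * a₃`, then the product of the cardinalities is small. -/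
theorem card_mul_card_mul_card_mul_le_of_notMem {H : Type} [Group H] [Fintype H] [DecidableEq H]
    {A₁ A₂ A₃ : Finset H} {g : H} (hg : g ∉ A₁ * A₂ * A₃) :
    (A₁.card : ℝ) * A₂.card * A₃.card * minNontrivialIrrepDim H ≤ (Fintype.card H : ℝ) ^ 3 := by
  have hn : (0 : ℝ) < Fintype.card H := by exact_mod_cast Fintype.card_pos
  rcases A₂.card.eq_zero_or_pos with h₂ | h₂
  · simp [h₂]
  rcases A₃.card.eq_zero_or_pos with h₃ | h₃
  · simp [h₃]
  let f : H → ℂ := fun x ↦ (if x ∈ A₂ then 1 else 0) - (A₂.card : ℂ) / Fintype.card H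
  let v : EuclideanSpace ℂ H := WithLp.toLp 2 fun x ↦ if x ∈ A₃ then 1 else 0
  have hf : ∑ x, f x = 0 := by
    have : (Fintype.card H : ℂ) ≠ 0 := by exact_mod_cast hn.ne'
    simp only [f, Finset.sum_sub_distrib, Finset.sum_boole, Finset.filter_univ_mem,
      Finset.sum_const, Finset.card_univ, nsmul_eq_mul]
    rw [mul_div_cancel₀ _ this, sub_self]
  have hv : ‖v‖ ^ 2 = A₃.card := by
    rw [EuclideanSpace.norm_sq_eq]
    simp [v, apply_ite]
  have hconv : ∀ a ∈ A₁, ‖convolutionOperator f v (a⁻¹ * g)‖ =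
      A₂.card * A₃.card / Fintype.card H := fun a ha ↦ by
    have hterm : ∀ y, f (a⁻¹ * g * y⁻¹) * v y =
        -((A₂.card : ℂ) / Fintype.card H) * if y ∈ A₃ then 1 else 0 := fun y ↦ by
      by_cases hy : y ∈ A₃
      · have : a⁻¹ * g * y⁻¹ ∉ A₂ := fun h ↦ hg <| by
          have := Finset.mul_mem_mul (Finset.mul_mem_mul ha h) hy
          simpa [mul_assoc] using this
        simp [f, v, hy, this]
      · simp [v, hy]
    rw [convolutionOperator_apply, Finset.sum_congr rfl fun y _ ↦ hterm y, ← Finset.mul_sum,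
      Finset.sum_boole]
    simp [mul_div_right_comm]
  have hlower : A₁.card * (A₂.card * A₃.card / Fintype.card H : ℝ) ^ 2 ≤
      ‖convolutionOperator f v‖ ^ 2 := by
    rw [EuclideanSpace.norm_sq_eq, ← Fintype.sum_equiv ((Equiv.inv H).trans (Equiv.mulRight g))
      (fun a ↦ ‖convolutionOperator f v (a⁻¹ * g)‖ ^ 2) _ fun _ ↦ rfl]
    calc _ = ∑ a ∈ A₁, ‖convolutionOperator f v (a⁻¹ * g)‖ ^ 2 := by
          rw [Finset.sum_congr rfl fun a ha ↦ by rw [hconv a ha]]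
          simp
      _ ≤ _ := Finset.sum_le_univ_sum_of_nonneg fun _ ↦ by positivity
  have hupper : ‖convolutionOperator f v‖ ^ 2 * minNontrivialIrrepDim H ≤
      Fintype.card H * A₂.card * A₃.card := by
    refine (norm_convolutionOperator_sq_mul_le hf v).trans ?_
    rw [hv]
    gcongr
    exact sum_norm_indicator_sub_average_sq_le A₂
  have h₂₃ : (0 : ℝ) < A₂.card * A₃.card := by positivity
  have hcombined := (mul_le_mul_of_nonneg_right hlower
    (Nat.cast_nonneg (minNontrivialIrrepDim H))).trans hupper
  refine le_of_mul_le_mul_left ?_ h₂₃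
  calc (A₂.card * A₃.card : ℝ) * (A₁.card * A₂.card * A₃.card * minNontrivialIrrepDim H)
      = A₁.card * (A₂.card * A₃.card / Fintype.card H : ℝ) ^ 2 * minNontrivialIrrepDim H *
          Fintype.card H ^ 2 := by field_simp
    _ ≤ Fintype.card H * A₂.card * A₃.card * Fintype.card H ^ 2 := by gcongr
    _ = A₂.card * A₃.card * Fintype.card H ^ 3 := by ring

/-- **Gowers' product theorem.**  If `H` is a finite group, `m(H)` is the minimal
dimension of a nontrivial complex irreducible representation of `H`, and
`A₁, A₂, A₃ ⊆ H` satisfy `|A₁|·|A₂|·|A₃| > |H|³ / m(H)`, then `A₁A₂A₃ = H`. -/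
theorem gowers_product_theorem {H : Type} [Group H] [Fintype H] [DecidableEq H]
    (A₁ A₂ A₃ : Finset H)
    (h : ((Fintype.card H : ℝ)) ^ 3 / (minNontrivialIrrepDim H : ℝ) <
      (A₁.card : ℝ) * (A₂.card : ℝ) * (A₃.card : ℝ)) :
    A₁ * A₂ * A₃ = (Finset.univ : Finset H) := by
  rcases subsingleton_or_nontrivial H with _ | _
  · have hpos : (0 : ℝ) < (A₁.card : ℝ) * A₂.card * A₃.card := lt_of_le_of_lt (by positivity) h
    have hne : (A₁ * A₂ * A₃).Nonempty := by
      refine (Finset.Nonempty.mul ?_ ?_).mul ?_ <;>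
      · rw [Finset.nonempty_iff_ne_empty]
        rintro rfl
        simp at hpos
    exact Finset.Nonempty.eq_univ hne
  · have hm : (0 : ℝ) < minNontrivialIrrepDim H := by exact_mod_cast minNontrivialIrrepDim_pos
    rw [div_lt_iff₀ hm] at h
    exact Finset.eq_univ_iff_forall.2 fun g ↦ by_contra fun hg ↦
      h.not_ge (card_mul_card_mul_card_mul_le_of_notMem hg)
end

section
/- Let p be an odd prime. The exponential series exp(x) = ∑_{n≥0} x^n/n! converges on p·M_d(Z_p) and defines an isometric bijection from p·M_d(Z_p) onto the congruence subgroup ker(GL_d(Z_p) → GL_d(Z/pZ)), with inverse given by the logarithm series log(1+x) = ∑_{n≥1} (−1)^{n−1} x^n/n. -/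
/-- The `p`-adic matrix exponential, `exp x = ∑ xⁿ/n!`. -/
noncomputable def padicMatExp {d p : ℕ} [Fact p.Prime] (x : Matrix (Fin d) (Fin d) ℚ_[p]) :
    Matrix (Fin d) (Fin d) ℚ_[p] :=
  ∑' n : ℕ, ((Nat.factorial n : ℚ_[p]))⁻¹ • x ^ n

/-- The `p`-adic matrix logarithm, `log g = ∑ (-1)^(n-1) (g-1)ⁿ/n`. -/
noncomputable def padicMatLog {d p : ℕ} [Fact p.Prime] (g : Matrix (Fin d) (Fin d) ℚ_[p]) :
    Matrix (Fin d) (Fin d) ℚ_[p] :=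
  ∑' n : ℕ, (((-1 : ℚ_[p]) ^ n) / (n + 1 : ℚ_[p])) • (g - 1) ^ (n + 1)

/-- The sup-norm of a matrix over `ℚ_p` (the maximum of the `p`-adic absolute values
of the entries). -/
noncomputable def matPadicNorm {d p : ℕ} [Fact p.Prime] (x : Matrix (Fin d) (Fin d) ℚ_[p]) : ℝ :=
  ⨆ i : Fin d, ⨆ j : Fin d, ‖x i j‖

open Filter Topology

section Coefficients
variable {p : ℕ} [Fact p.Prime]

theorem Padic.norm_factorial_inv_le (hp : p ≠ 2) (n : ℕ) :
    ‖((n + 1).factorial : ℚ_[p])⁻¹‖ ≤ (p : ℝ) ^ (n / 2) := by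
  have hp2 : 2 ≤ p - 1 := by have := (Fact.out : p.Prime).two_le; omega
  have hlt := sub_one_mul_padicValNat_factorial_lt_of_ne_zero p n.succ_ne_zero
  have hle : padicValNat p (n + 1).factorial ≤ n / 2 := by
    have := Nat.mul_le_mul_right (padicValNat p (n + 1).factorial) hp2
    simp only [Nat.succ_eq_add_one] at hlt
    omega
  have h0 : ((n + 1).factorial : ℚ_[p]) ≠ 0 := by exact_mod_cast (n + 1).factorial_ne_zero
  rw [norm_inv, Padic.norm_eq_zpow_neg_valuation h0, Padic.valuation_natCast, zpow_neg, inv_inv,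
    zpow_natCast]
  exact pow_le_pow_right₀ (by exact_mod_cast (Fact.out : p.Prime).one_le) hle

theorem Padic.norm_inv_natCast_le_norm_factorial_inv (n : ℕ) :
    ‖((n : ℚ_[p]) + 1)⁻¹‖ ≤ ‖((n + 1).factorial : ℚ_[p])⁻¹‖ := by
  have h0 : ((n + 1).factorial : ℚ_[p]) ≠ 0 := by exact_mod_cast (n + 1).factorial_ne_zero
  rw [norm_inv, norm_inv]
  refine inv_anti₀ (norm_pos_iff.mpr h0) ?_
  rw [Nat.factorial_succ, Nat.cast_mul, norm_mul, Nat.cast_succ]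
  exact mul_le_of_le_one_right (norm_nonneg _) (IsUltrametricDist.norm_natCast_le_one ℚ_[p] _)

theorem Padic.norm_factorial_inv_mul_pow_le (hp : p ≠ 2) (n : ℕ) :
    ‖((n + 1).factorial : ℚ_[p])⁻¹‖ * (p : ℝ)⁻¹ ^ (n + 1) ≤ √(p : ℝ)⁻¹ ^ (n + 1) := by
  have hp0 : (0 : ℝ) < p := by exact_mod_cast (Fact.out : p.Prime).pos
  have hp1 : (p : ℝ)⁻¹ ≤ 1 := inv_le_one_of_one_le₀ (by exact_mod_cast (Fact.out : p.Prime).one_le)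
  calc _ ≤ (p : ℝ) ^ (n / 2) * (p : ℝ)⁻¹ ^ (n + 1) := by
        gcongr; exact Padic.norm_factorial_inv_le hp n
    _ = (p : ℝ)⁻¹ ^ (n + 1 - n / 2) := by
        conv_lhs => rw [show n + 1 = n / 2 + (n + 1 - n / 2) by omega, pow_add, ← mul_assoc,
          ← mul_pow, mul_inv_cancel₀ hp0.ne', one_pow, one_mul]
    _ = √(p : ℝ)⁻¹ ^ (2 * (n + 1 - n / 2)) := by rw [pow_mul, Real.sq_sqrt (by positivity)]
    _ ≤ _ := pow_le_pow_of_le_one (by positivity) (Real.sqrt_le_one.mpr hp1) (by omega)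

theorem Padic.summable_sqrt_inv_pow : Summable fun n : ℕ => √(p : ℝ)⁻¹ ^ (n + 1) := by
  refine (summable_nat_add_iff 1).mpr (summable_geometric_of_lt_one (by positivity) ?_)
  rw [Real.sqrt_lt' one_pos, one_pow]
  exact inv_lt_one_of_one_lt₀ (by exact_mod_cast (Fact.out : p.Prime).one_lt)

theorem Padic.norm_factorial_inv_mul_pow_le_self (hp : p ≠ 2) {r : ℝ} (h0 : 0 ≤ r)
    (hr : r ≤ (p : ℝ)⁻¹) (n : ℕ) :
    ‖((n + 2).factorial : ℚ_[p])⁻¹‖ * r ^ (n + 1) ≤ r := by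
  have hp0 : (0 : ℝ) < p := by exact_mod_cast (Fact.out : p.Prime).pos
  have hp1 : (1 : ℝ) ≤ p := by exact_mod_cast (Fact.out : p.Prime).one_le
  have hpr : p * r ≤ 1 := by
    calc p * r ≤ p * (p : ℝ)⁻¹ := by gcongr
      _ = 1 := mul_inv_cancel₀ hp0.ne'
  calc _ ≤ (p : ℝ) ^ ((n + 1) / 2) * r ^ (n + 1) := by
        gcongr; exact Padic.norm_factorial_inv_le hp (n + 1)
    _ ≤ (p : ℝ) ^ n * r ^ (n + 1) := by gcongr; omega
    _ = (p * r) ^ n * r := by ring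
    _ ≤ r := mul_le_of_le_one_left h0 (pow_le_one₀ (by positivity) hpr)

theorem Padic.tendsto_natCast_prime_pow : Tendsto (fun m : ℕ => (p : ℚ_[p]) ^ m) atTop (𝓝 0) :=
  tendsto_pow_atTop_nhds_zero_of_norm_lt_one Padic.norm_p_lt_one

theorem Padic.natCast_choose_prime_pow_succ (m k : ℕ) :
    ((p ^ m).choose (k + 1) : ℚ_[p]) =
      (p : ℚ_[p]) ^ m * ((p ^ m - 1).choose k / ((k : ℚ_[p]) + 1)) := by
  have h := Nat.add_one_mul_choose_eq (p ^ m - 1) k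
  rw [Nat.sub_add_cancel (Nat.pow_pos (Fact.out : p.Prime).pos)] at h
  have h' := congrArg (Nat.cast : ℕ → ℚ_[p]) h
  push_cast at h'
  have hk : (k : ℚ_[p]) + 1 ≠ 0 := Nat.cast_add_one_ne_zero k
  field_simp
  exact h'.symm

theorem Padic.tendsto_choose_prime_pow_sub_one (k : ℕ) :
    Tendsto (fun m : ℕ => ((p ^ m - 1).choose k : ℚ_[p])) atTop (𝓝 ((-1) ^ k)) := by
  induction k with
  | zero => simp
  | succ k ih =>
    have h : ∀ m : ℕ, ((p ^ m - 1).choose (k + 1) : ℚ_[p]) =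
        (p : ℚ_[p]) ^ m * ((p ^ m - 1).choose k / ((k : ℚ_[p]) + 1)) - (p ^ m - 1).choose k := by
      intro m
      rw [← natCast_choose_prime_pow_succ, eq_sub_iff_add_eq', ← Nat.cast_add, ← Nat.choose_succ_succ,
        Nat.succ_eq_add_one, Nat.sub_add_cancel (Nat.pow_pos (Fact.out : p.Prime).pos)]
    simp_rw [h]
    convert (Padic.tendsto_natCast_prime_pow.mul (ih.div_const ((k : ℚ_[p]) + 1))).sub ih using 2
    ring

end Coefficients

theorem norm_pow_succ_sub_pow_succ_le {A : Type*} [NormedRing A] [IsUltrametricDist A]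
    {x y : A} {r : ℝ} (hx : ‖x‖ ≤ r) (hy : ‖y‖ ≤ r) (n : ℕ) :
    ‖x ^ (n + 1) - y ^ (n + 1)‖ ≤ r ^ n * ‖x - y‖ := by
  have hr : 0 ≤ r := (norm_nonneg x).trans hx
  induction n with
  | zero => simp
  | succ n ih =>
    rw [show x ^ (n + 1 + 1) - y ^ (n + 1 + 1) =
      x ^ (n + 1) * (x - y) + (x ^ (n + 1) - y ^ (n + 1)) * y by
        rw [pow_succ x (n + 1), pow_succ y (n + 1)]; noncomm_ring]
    refine (IsUltrametricDist.norm_add_le_max _ _).trans (max_le ?_ ?_)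
    · refine (norm_mul_le _ _).trans ?_
      gcongr
      exact (norm_pow_le' x n.succ_pos).trans (by gcongr)
    · calc _ ≤ _ := norm_mul_le _ _
        _ ≤ (r ^ n * ‖x - y‖) * r := by gcongr
        _ = _ := by ring

section BanachAlgebra
variable {p : ℕ} [Fact p.Prime] {A : Type*} [NormedRing A] [NormedAlgebra ℚ_[p] A]

variable (p) in
/-- The exponential series in a `p`-adic normed algebra. -/
noncomputable def padicExp (x : A) : A :=
  ∑' n : ℕ, ((Nat.factorial n : ℚ_[p]))⁻¹ • x ^ n

variable (p) in
/-- The series `log g = ∑ (-1)^n (g-1)^(n+1)/(n+1)` in a `p`-adic normed algebra. -/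
noncomputable def padicLog (g : A) : A :=
  ∑' n : ℕ, (((-1 : ℚ_[p]) ^ n) / (n + 1 : ℚ_[p])) • (g - 1) ^ (n + 1)

theorem norm_smul_pow_succ_le_of_norm_le_inv (hp : p ≠ 2) {x : A} (hx : ‖x‖ ≤ (p : ℝ)⁻¹) {n : ℕ}
    {c : ℚ_[p]} (hc : ‖c‖ ≤ ‖((n + 1).factorial : ℚ_[p])⁻¹‖) :
    ‖c • x ^ (n + 1)‖ ≤ √(p : ℝ)⁻¹ ^ (n + 1) := by
  refine le_trans ?_ (Padic.norm_factorial_inv_mul_pow_le hp n)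
  refine (norm_smul_le _ _).trans ?_
  gcongr
  exact (norm_pow_le' x n.succ_pos).trans (by gcongr)

theorem summable_norm_padicExp (hp : p ≠ 2) {x : A} (hx : ‖x‖ ≤ (p : ℝ)⁻¹) :
    Summable fun n : ℕ => ‖((Nat.factorial n : ℚ_[p]))⁻¹ • x ^ n‖ :=
  (summable_nat_add_iff 1).mp <| Padic.summable_sqrt_inv_pow.of_nonneg_of_le
    (fun _ => norm_nonneg _) fun _ => norm_smul_pow_succ_le_of_norm_le_inv hp hx le_rfl

theorem padicExp_zero : padicExp p (0 : A) = 1 := by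
  rw [padicExp, tsum_eq_single 0 fun n hn => by simp [hn]]
  simp

theorem norm_natCast_smul_le (m : ℕ) (x : A) : ‖(m : ℚ_[p]) • x‖ ≤ ‖x‖ := by
  rw [norm_smul]
  exact mul_le_of_le_one_left (norm_nonneg _) (IsUltrametricDist.norm_natCast_le_one ℚ_[p] _)

variable [CompleteSpace A]

theorem padicExp_add_of_commute (hp : p ≠ 2) {x y : A} (hx : ‖x‖ ≤ (p : ℝ)⁻¹)
    (hy : ‖y‖ ≤ (p : ℝ)⁻¹) (hxy : Commute x y) :
    padicExp p (x + y) = padicExp p x * padicExp p y := by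
  simp only [padicExp]
  rw [tsum_mul_tsum_eq_tsum_sum_antidiagonal_of_summable_norm
    (summable_norm_padicExp hp hx) (summable_norm_padicExp hp hy)]
  refine tsum_congr fun n => ?_
  rw [hxy.add_pow' _, Finset.smul_sum]
  refine Finset.sum_congr rfl fun kl hkl => ?_
  rw [← Nat.cast_smul_eq_nsmul ℚ_[p], smul_smul, smul_mul_smul_comm,
    ← Finset.HasAntidiagonal.mem_antidiagonal.mp hkl, Nat.cast_add_choose,
    Finset.HasAntidiagonal.mem_antidiagonal.mp hkl]
  field_simp [n.factorial_ne_zero]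

theorem padicExp_mul_padicExp_neg (hp : p ≠ 2) {x : A} (hx : ‖x‖ ≤ (p : ℝ)⁻¹) :
    padicExp p x * padicExp p (-x) = 1 := by
  rw [← padicExp_add_of_commute hp hx (by rwa [norm_neg]) (Commute.neg_right (.refl x)),
    add_neg_cancel, padicExp_zero]

theorem padicExp_natCast_smul (hp : p ≠ 2) {x : A} (hx : ‖x‖ ≤ (p : ℝ)⁻¹) (m : ℕ) :
    padicExp p ((m : ℚ_[p]) • x) = padicExp p x ^ m := by
  induction m with
  | zero => simp [padicExp_zero]
  | succ m ih =>
    rw [Nat.cast_succ, add_smul, one_smul, padicExp_add_of_commute hp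
      ((norm_natCast_smul_le m x).trans hx) hx (Commute.smul_left (.refl x) _), ih, pow_succ]

/-- For `‖g - 1‖ ≤ p⁻¹`, the logarithm is the limit of `(g ^ p ^ m - 1) / p ^ m`. -/
theorem tendsto_inv_smul_pow_sub_one_padicLog (hp : p ≠ 2) {g : A} (hg : ‖g - 1‖ ≤ (p : ℝ)⁻¹) :
    Tendsto (fun m : ℕ => ((p : ℚ_[p]) ^ m)⁻¹ • (g ^ p ^ m - 1)) atTop (𝓝 (padicLog p g)) := by
  have hsum : ∀ m : ℕ, ((p : ℚ_[p]) ^ m)⁻¹ • (g ^ p ^ m - 1) =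
      ∑' k : ℕ, (((p ^ m - 1).choose k : ℚ_[p]) / (k + 1)) • (g - 1) ^ (k + 1) := by
    intro m
    have hpm : (p : ℚ_[p]) ^ m ≠ 0 :=
      pow_ne_zero _ (by exact_mod_cast (Fact.out : p.Prime).ne_zero)
    rw [tsum_eq_sum (s := Finset.range (p ^ m))]
    · conv_lhs => rw [← sub_add_cancel g 1, (Commute.one_right (g - 1)).add_pow,
        Finset.sum_range_succ']
      simp only [one_pow, mul_one, pow_zero, Nat.choose_zero_right, Nat.cast_one,
        add_sub_cancel_right, Finset.smul_sum]
      refine Finset.sum_congr rfl fun k _ => ?_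
      rw [← nsmul_eq_mul', ← Nat.cast_smul_eq_nsmul ℚ_[p], Padic.natCast_choose_prime_pow_succ,
        smul_smul, inv_mul_cancel_left₀ hpm]
    · intro k hk
      rw [Nat.choose_eq_zero_of_lt]
      · simp
      · have := Nat.pow_pos (n := m) (Fact.out : p.Prime).pos
        rw [Finset.mem_range] at hk
        omega
  simp_rw [hsum]
  refine tendsto_tsum_of_dominated_convergence Padic.summable_sqrt_inv_pow
    (fun k => ((Padic.tendsto_choose_prime_pow_sub_one k).div_const _).smul_const _)
    (.of_forall fun m k => norm_smul_pow_succ_le_of_norm_le_inv hp hg ?_)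
  refine le_trans ?_ (Padic.norm_inv_natCast_le_norm_factorial_inv k)
  rw [div_eq_mul_inv, norm_mul]
  exact mul_le_of_le_one_left (norm_nonneg _) (IsUltrametricDist.norm_natCast_le_one ℚ_[p] _)

variable [IsUltrametricDist A]

theorem norm_padicExp_sub_sub_le (hp : p ≠ 2) {x y : A} {r : ℝ} (hr : r ≤ (p : ℝ)⁻¹)
    (hx : ‖x‖ ≤ r) (hy : ‖y‖ ≤ r) :
    ‖padicExp p x - padicExp p y - (x - y)‖ ≤ r * ‖x - y‖ := by
  have hr0 : 0 ≤ r := (norm_nonneg x).trans hx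
  have hsx := (summable_norm_padicExp hp (hx.trans hr)).of_norm
  have hsy := (summable_norm_padicExp hp (hy.trans hr)).of_norm
  have h : padicExp p x - padicExp p y - (x - y) =
      ∑' n : ℕ, ((n + 2).factorial : ℚ_[p])⁻¹ • (x ^ (n + 2) - y ^ (n + 2)) := by
    rw [padicExp, padicExp, ← hsx.tsum_sub hsy, ← (hsx.sub hsy).sum_add_tsum_nat_add 2]
    simp [Finset.sum_range_succ, smul_sub]
  rw [h]
  refine (IsUltrametricDist.norm_tsum_le _).trans (ciSup_le fun n => ?_)
  calc _ ≤ ‖((n + 2).factorial : ℚ_[p])⁻¹‖ * (r ^ (n + 1) * ‖x - y‖) :=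
        (norm_smul_le _ _).trans (by gcongr; exact norm_pow_succ_sub_pow_succ_le hx hy (n + 1))
    _ = (‖((n + 2).factorial : ℚ_[p])⁻¹‖ * r ^ (n + 1)) * ‖x - y‖ := by ring
    _ ≤ _ := by gcongr; exact Padic.norm_factorial_inv_mul_pow_le_self hp hr0 hr n

theorem norm_padicExp_sub_padicExp (hp : p ≠ 2) {x y : A} (hx : ‖x‖ ≤ (p : ℝ)⁻¹)
    (hy : ‖y‖ ≤ (p : ℝ)⁻¹) : ‖padicExp p x - padicExp p y‖ = ‖x - y‖ := by
  rcases eq_or_ne x y with rfl | hxy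
  · simp
  have hlt : ‖padicExp p x - padicExp p y - (x - y)‖ < ‖x - y‖ :=
    (norm_padicExp_sub_sub_le hp le_rfl hx hy).trans_lt <|
      mul_lt_of_lt_one_left (norm_pos_iff.mpr (sub_ne_zero.mpr hxy))
        (inv_lt_one_of_one_lt₀ (by exact_mod_cast (Fact.out : p.Prime).one_lt))
  rw [← sub_add_cancel (padicExp p x - padicExp p y) (x - y),
    IsUltrametricDist.norm_add_eq_max_of_norm_ne_norm hlt.ne, max_eq_right hlt.le]

theorem norm_padicExp_sub_one (hp : p ≠ 2) {x : A} (hx : ‖x‖ ≤ (p : ℝ)⁻¹) :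
    ‖padicExp p x - 1‖ = ‖x‖ := by
  simpa [padicExp_zero] using
    norm_padicExp_sub_padicExp hp hx (show ‖(0 : A)‖ ≤ (p : ℝ)⁻¹ by simp)

/-- For `‖x‖ ≤ p⁻¹`, `x` is the limit of `(exp x ^ p ^ m - 1) / p ^ m`. -/
theorem tendsto_inv_smul_padicExp_pow_sub_one (hp : p ≠ 2) {x : A} (hx : ‖x‖ ≤ (p : ℝ)⁻¹) :
    Tendsto (fun m : ℕ => ((p : ℚ_[p]) ^ m)⁻¹ • (padicExp p x ^ p ^ m - 1)) atTop (𝓝 x) := by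
  have hlim : Tendsto (fun m : ℕ => ‖(p : ℚ_[p]) ^ m‖ * (‖x‖ * ‖x‖)) atTop (𝓝 0) := by
    simpa using (Padic.tendsto_natCast_prime_pow (p := p)).norm.mul_const (‖x‖ * ‖x‖)
  refine tendsto_iff_norm_sub_tendsto_zero.mpr
    (squeeze_zero (fun _ => norm_nonneg _) (fun m => ?_) hlim)
  have hpm : (p : ℚ_[p]) ^ m ≠ 0 := pow_ne_zero _ (by exact_mod_cast (Fact.out : p.Prime).ne_zero)
  have hle : ‖(p : ℚ_[p]) ^ m • x‖ ≤ ‖x‖ := by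
    simpa using norm_natCast_smul_le (p := p) (p ^ m) x
  have hexp := norm_padicExp_sub_sub_le hp (hle.trans hx) le_rfl
    (show ‖(0 : A)‖ ≤ ‖(p : ℚ_[p]) ^ m • x‖ by simp)
  rw [padicExp_zero, sub_zero] at hexp
  rw [← padicExp_natCast_smul hp hx, Nat.cast_pow]
  calc _ = ‖((p : ℚ_[p]) ^ m)⁻¹ •
        (padicExp p ((p : ℚ_[p]) ^ m • x) - 1 - (p : ℚ_[p]) ^ m • x)‖ := by
        rw [smul_sub _ _ ((p : ℚ_[p]) ^ m • x), inv_smul_smul₀ hpm]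
    _ ≤ ‖(p : ℚ_[p]) ^ m‖⁻¹ * (‖(p : ℚ_[p]) ^ m • x‖ * ‖(p : ℚ_[p]) ^ m • x‖) := by
        rw [norm_smul, norm_inv]; gcongr
    _ = _ := by
        have : ‖(p : ℚ_[p]) ^ m‖ ≠ 0 := norm_ne_zero_iff.mpr hpm
        rw [norm_smul]; field_simp

theorem padicLog_padicExp (hp : p ≠ 2) {x : A} (hx : ‖x‖ ≤ (p : ℝ)⁻¹) :
    padicLog p (padicExp p x) = x :=
  tendsto_nhds_unique
    (tendsto_inv_smul_pow_sub_one_padicLog hp ((norm_padicExp_sub_one hp hx).trans_le hx))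
    (tendsto_inv_smul_padicExp_pow_sub_one hp hx)

theorem exists_padicExp_eq (hp : p ≠ 2) {g : A} (hg : ‖g - 1‖ ≤ (p : ℝ)⁻¹) :
    ∃ x : A, ‖x‖ ≤ (p : ℝ)⁻¹ ∧ padicExp p x = g := by
  let T : A → A := fun x => x - padicExp p x + g
  have hT : Set.MapsTo T (Metric.closedBall 0 (p : ℝ)⁻¹) (Metric.closedBall 0 (p : ℝ)⁻¹) := by
    intro x hx
    rw [mem_closedBall_zero_iff] at hx ⊢
    rw [show T x = x + (-(padicExp p x - 1) + (g - 1)) by simp only [T]; abel]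
    refine (IsUltrametricDist.norm_add_le_max _ _).trans (max_le hx ?_)
    refine (IsUltrametricDist.norm_add_le_max _ _).trans (max_le ?_ hg)
    rwa [norm_neg, norm_padicExp_sub_one hp hx]
  have hcontr : ContractingWith (p : NNReal)⁻¹ (hT.restrict T _ _) := by
    refine ⟨inv_lt_one_of_one_lt₀ (by exact_mod_cast (Fact.out : p.Prime).one_lt),
      LipschitzWith.of_dist_le_mul fun x y => ?_⟩
    have h := norm_padicExp_sub_sub_le hp le_rfl (mem_closedBall_zero_iff.mp x.2)
      (mem_closedBall_zero_iff.mp y.2)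
    rw [Subtype.dist_eq, Subtype.dist_eq, dist_eq_norm, dist_eq_norm, Set.MapsTo.val_restrict_apply,
      Set.MapsTo.val_restrict_apply, norm_sub_rev, NNReal.coe_inv, NNReal.coe_natCast]
    rwa [show T y - T x = padicExp p (x : A) - padicExp p (y : A) - (x - y) by
      simp only [T]; abel]
  obtain ⟨x, hx, hfix, -⟩ := hcontr.exists_fixedPoint' Metric.isClosed_closedBall.isComplete hT
    (Metric.mem_closedBall_self (by positivity)) (edist_ne_top _ _)
  refine ⟨x, mem_closedBall_zero_iff.mp hx, ?_⟩
  have h : x - padicExp p x + g = x := hfix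
  rw [sub_add_eq_add_sub, sub_eq_iff_eq_add, add_right_inj] at h
  exact h.symm

end BanachAlgebra

section SupNorm
variable {d p : ℕ} [Fact p.Prime]

open scoped Matrix.Norms.Elementwise

theorem Matrix.norm_mul_le_of_isUltrametricDist (x y : Matrix (Fin d) (Fin d) ℚ_[p]) :
    ‖x * y‖ ≤ ‖x‖ * ‖y‖ := by
  refine (Matrix.norm_le_iff (by positivity)).mpr fun i j => ?_
  rw [Matrix.mul_apply]
  refine IsUltrametricDist.norm_sum_le_of_forall_le_of_nonneg (by positivity) fun k _ => ?_
  rw [norm_mul]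
  gcongr <;> exact Matrix.norm_entry_le_entrywise_sup_norm _

/-- The ring of square `p`-adic matrices, normed by the maximum of the norms of the entries. -/
@[reducible]
noncomputable def Matrix.padicNormedRing : NormedRing (Matrix (Fin d) (Fin d) ℚ_[p]) where
  __ := (inferInstance : Ring (Matrix (Fin d) (Fin d) ℚ_[p]))
  __ := (Matrix.normedAddCommGroup : NormedAddCommGroup (Matrix (Fin d) (Fin d) ℚ_[p]))
  norm_mul_le := Matrix.norm_mul_le_of_isUltrametricDist

attribute [local instance] Matrix.padicNormedRing

/-- The algebra of square `p`-adic matrices, normed by the maximum of the norms of the entries. -/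
@[reducible]
noncomputable def Matrix.padicNormedAlgebra :
    NormedAlgebra ℚ_[p] (Matrix (Fin d) (Fin d) ℚ_[p]) where
  __ := (inferInstance : Algebra ℚ_[p] (Matrix (Fin d) (Fin d) ℚ_[p]))
  norm_smul_le := fun c x => (Matrix.normedSpace (R := ℚ_[p])).norm_smul_le c x

attribute [local instance] Matrix.padicNormedAlgebra

theorem Matrix.isUltrametricDist_padic : IsUltrametricDist (Matrix (Fin d) (Fin d) ℚ_[p]) :=
  inferInstanceAs (IsUltrametricDist (Fin d → Fin d → ℚ_[p]))

theorem Matrix.completeSpace_padic :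
    @CompleteSpace (Matrix (Fin d) (Fin d) ℚ_[p]) PseudoMetricSpace.toUniformSpace :=
  inferInstanceAs (CompleteSpace (Fin d → Fin d → ℚ_[p]))

attribute [local instance] Matrix.isUltrametricDist_padic Matrix.completeSpace_padic

theorem matPadicNorm_eq_norm (x : Matrix (Fin d) (Fin d) ℚ_[p]) : matPadicNorm x = ‖x‖ := by
  refine le_antisymm ?_ ?_
  · exact Real.iSup_le (fun i => Real.iSup_le
      (fun j => Matrix.norm_entry_le_entrywise_sup_norm x) (norm_nonneg _)) (norm_nonneg _)
  · refine (Matrix.norm_le_iff (Real.iSup_nonneg fun i => Real.iSup_nonneg fun j =>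
      norm_nonneg _)).mpr fun i j => ?_
    exact (le_ciSup (f := fun j => ‖x i j‖) (Set.finite_range _).bddAbove j).trans
      (le_ciSup (f := fun i => ⨆ j, ‖x i j‖) (Set.finite_range _).bddAbove i)

theorem Matrix.norm_padic_one_le : ‖(1 : Matrix (Fin d) (Fin d) ℚ_[p])‖ ≤ 1 := by
  refine (Matrix.norm_le_iff zero_le_one).mpr fun i j => ?_
  rw [Matrix.one_apply]
  split_ifs <;> simp

theorem norm_padicExp_le_one (hp : p ≠ 2) {x : Matrix (Fin d) (Fin d) ℚ_[p]}
    (hx : ‖x‖ ≤ (p : ℝ)⁻¹) : ‖padicExp p x‖ ≤ 1 := by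
  rw [← sub_add_cancel (padicExp p x) 1]
  refine (IsUltrametricDist.norm_add_le_max _ _).trans (max_le ?_ Matrix.norm_padic_one_le)
  rw [norm_padicExp_sub_one hp hx]
  exact hx.trans (inv_le_one_of_one_le₀ (by exact_mod_cast (Fact.out : p.Prime).one_le))

/-- For an odd prime `p`, the exponential series converges on `p·M_d(ℤ_p)` and defines an
isometric bijection from `p·M_d(ℤ_p)` onto `ker(GL_d(ℤ_p) → GL_d(ℤ/pℤ))` (matrices over `ℤ_p`
that are invertible and congruent to `1` mod `p`), with inverse the logarithm series. -/
theorem padic_exp_isometric_bijection (d p : ℕ) [Fact p.Prime] (hp : p ≠ 2) :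
    (∀ x ∈ {x : Matrix (Fin d) (Fin d) ℚ_[p] | ∀ i j, ‖x i j‖ ≤ ((p : ℝ))⁻¹},
        Summable (fun n : ℕ => ((Nat.factorial n : ℚ_[p]))⁻¹ • x ^ n)) ∧
    Set.BijOn padicMatExp
      {x : Matrix (Fin d) (Fin d) ℚ_[p] | ∀ i j, ‖x i j‖ ≤ ((p : ℝ))⁻¹}
      {g : Matrix (Fin d) (Fin d) ℚ_[p] |
        IsUnit g ∧ (∀ i j, ‖g i j‖ ≤ 1) ∧ (∀ i j, ‖(g - 1) i j‖ ≤ ((p : ℝ))⁻¹) ∧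
        ∀ i j, ‖g⁻¹ i j‖ ≤ 1} ∧
    (∀ x ∈ {x : Matrix (Fin d) (Fin d) ℚ_[p] | ∀ i j, ‖x i j‖ ≤ ((p : ℝ))⁻¹},
      ∀ y ∈ {x : Matrix (Fin d) (Fin d) ℚ_[p] | ∀ i j, ‖x i j‖ ≤ ((p : ℝ))⁻¹},
        matPadicNorm (padicMatExp x - padicMatExp y) = matPadicNorm (x - y)) ∧
    (∀ x ∈ {x : Matrix (Fin d) (Fin d) ℚ_[p] | ∀ i j, ‖x i j‖ ≤ ((p : ℝ))⁻¹},
      padicMatLog (padicMatExp x) = x) ∧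
    (∀ g ∈ {g : Matrix (Fin d) (Fin d) ℚ_[p] |
        IsUnit g ∧ (∀ i j, ‖g i j‖ ≤ 1) ∧ (∀ i j, ‖(g - 1) i j‖ ≤ ((p : ℝ))⁻¹) ∧
        ∀ i j, ‖g⁻¹ i j‖ ≤ 1},
      padicMatExp (padicMatLog g) = g) := by
  have hball : ∀ x : Matrix (Fin d) (Fin d) ℚ_[p],
      (∀ i j, ‖x i j‖ ≤ (p : ℝ)⁻¹) → ‖x‖ ≤ (p : ℝ)⁻¹ :=
    fun x hx => (Matrix.norm_le_iff (by positivity)).mpr hx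
  refine ⟨fun x hx => (summable_norm_padicExp hp (hball x hx)).of_norm,
    ⟨fun x hx => ?_, fun x hx y hy hxy => ?_, fun g hg => ?_⟩, fun x hx y hy => ?_,
    fun x hx => padicLog_padicExp hp (hball x hx), fun g hg => ?_⟩
  · have hnx := hball x hx
    have hmul : padicMatExp x * padicExp p (-x) = 1 := padicExp_mul_padicExp_neg hp hnx
    refine ⟨(Matrix.isUnit_iff_isUnit_det _).mpr (Matrix.isUnit_det_of_right_inverse hmul),
      (Matrix.norm_le_iff zero_le_one).mp (norm_padicExp_le_one hp hnx),
      (Matrix.norm_le_iff (by positivity)).mp ((norm_padicExp_sub_one hp hnx).trans_le hnx), ?_⟩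
    rw [Matrix.inv_eq_right_inv hmul]
    exact (Matrix.norm_le_iff zero_le_one).mp (norm_padicExp_le_one hp (by rwa [norm_neg]))
  · rw [← padicLog_padicExp hp (hball x hx), ← padicLog_padicExp hp (hball y hy)]
    exact congrArg (padicLog p) hxy
  · obtain ⟨x, hx, rfl⟩ := exists_padicExp_eq hp (hball _ hg.2.2.1)
    exact ⟨x, (Matrix.norm_le_iff (by positivity)).mp hx, rfl⟩
  · rw [matPadicNorm_eq_norm, matPadicNorm_eq_norm]
    exact norm_padicExp_sub_padicExp hp (hball x hx) (hball y hy)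
  · obtain ⟨x, hx, rfl⟩ := exists_padicExp_eq hp (hball _ hg.2.2.1)
    exact congrArg (padicExp p) (padicLog_padicExp hp hx)

end SupNorm
end
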